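/- arXiv:1506.07833 — 3 statements merged into one kernel-verified Lean document; each statement's English description precedes it below -/
import Mathlib

section
/- The transformation E₂(-1/τ) = τ²·E₂(τ) + 6τ/(πi) holds for all τ in the upper half plane, where E₂(τ) = 1 - 24·∑_{n≥1} σ₁(n) e^{2πinτ}. Equivalently, the completed function Ê₂(τ) = E₂(τ) - 3/(π·Im(τ)) satisfies Ê₂(-1/τ) = τ²·Ê₂(τ). -/
open Complex

/-- Sum of divisors function σ₁. -/
noncomputable def sigma1 (n : ℕ) : ℕ := ∑ d ∈ n.divisors, d

/-- The quasimodular Eisenstein series E₂ as a function of τ in the upper half plane. -/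
noncomputable def E2 (τ : ℂ) : ℂ :=
  1 - 24 * ∑' n : ℕ, (sigma1 (n + 1) : ℂ) *
    Complex.exp (2 * Real.pi * Complex.I * ((n : ℂ) + 1) * τ)

lemma E2_eq_mathlib (z : UpperHalfPlane) : E2 (z : ℂ) = EisensteinSeries.E2 z := by
  rw [EisensteinSeries.E2_eq_tsum_cexp,
    tsum_pnat_eq_tsum_succ (f := fun n : ℕ ↦
      ((ArithmeticFunction.sigma 1 n : ℕ) : ℂ) * Complex.exp (2 * Real.pi * I * z) ^ n), E2]
  congr 2
  refine tsum_congr fun n => ?_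
  congr 1
  · simp [sigma1, ArithmeticFunction.sigma_one_apply]
  · rw [← Complex.exp_nat_mul]
    congr 1
    push_cast
    ring

lemma E2_S (τ : ℂ) (hτ : 0 < τ.im) :
    E2 (-1 / τ) = τ ^ 2 * E2 τ + 6 * τ / (Real.pi * Complex.I) := by
  have h0 : τ ≠ 0 := by rintro rfl; simp at hτ
  have hpi : (Real.pi : ℂ) ≠ 0 := by exact_mod_cast Real.pi_ne_zero
  let z : UpperHalfPlane := ⟨τ, hτ⟩
  have hz : (z : ℂ) = τ := rfl
  have h := congrFun (EisensteinSeries.E2_slash_action ModularGroup.S) z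
  rw [ModularForm.SL_slash_apply, UpperHalfPlane.modular_S_smul] at h
  simp only [Pi.sub_apply, Pi.smul_apply, EisensteinSeries.D2, ModularGroup.denom_S, smul_eq_mul,
    riemannZeta_two] at h
  rw [← E2_eq_mathlib, ← E2_eq_mathlib] at h
  have e : ((UpperHalfPlane.mk (-(z : ℂ))⁻¹ z.im_inv_neg_coe_pos : UpperHalfPlane) : ℂ) = -1 / τ := by
    change (-τ)⁻¹ = _
    rw [inv_neg]; ring
  rw [e, hz] at h
  simp [ModularGroup.S] at h
  have h2 : E2 (-1 / τ) = τ ^ 2 * (E2 (-1 / τ) * (τ ^ 2)⁻¹) := by field_simp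
  rw [h2, h]
  field_simp
  ring_nf
  simp only [I_sq]
  ring

theorem stmt7 (τ : ℂ) (hτ : 0 < τ.im) :
    E2 (-1 / τ) = τ ^ 2 * E2 τ + 6 * τ / (Real.pi * Complex.I)
      ∧ E2 (-1 / τ) - 3 / (Real.pi * (-1 / τ).im)
          = τ ^ 2 * (E2 τ - 3 / (Real.pi * τ.im)) := by
  have h0 : τ ≠ 0 := by rintro rfl; simp at hτ
  have hpi : (Real.pi : ℂ) ≠ 0 := by exact_mod_cast Real.pi_ne_zero
  refine ⟨E2_S τ hτ, ?_⟩
  rw [E2_S τ hτ]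
  have hy : (τ.im : ℂ) ≠ 0 := by exact_mod_cast hτ.ne'
  have hc : (starRingEnd ℂ) τ ≠ 0 := by simpa using h0
  have him : (((-1 / τ).im : ℝ) : ℂ) = τ.im / (τ * (starRingEnd ℂ) τ) := by
    rw [Complex.mul_conj, ← Complex.ofReal_div]
    congr 1
    simp [Complex.div_im]
    ring
  have hcc : (starRingEnd ℂ) τ = τ - 2 * τ.im * I := by
    apply Complex.ext <;> simp <;> ring
  rw [him]
  rw [hcc] at hc ⊢
  field_simp
  ring_nf
  simp only [I_sq]
  ring
end

section
/- The derivative of the Jacobi theta function at z = 0 satisfies ∂/∂z[ϑ(z;τ)]_{z=0} = -2π·η(τ)³, where ϑ(z;τ) = ∑_{n ∈ 1/2 + ℤ} q^{n²/2} e^{2πi(z+1/2)n} and η(τ) = q^{1/24}·∏_{n≥1}(1 - qⁿ) with q = e^{2πiτ}. -/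
/-- The Jacobi theta function ϑ(z;τ) = ∑_{n ∈ 1/2+ℤ} q^{n²/2} e^{2πi(z+1/2)n}. -/
noncomputable def jTheta (z τ : ℂ) : ℂ :=
  ∑' n : ℤ, Complex.exp (Real.pi * Complex.I * τ * ((n : ℂ) + 1 / 2) ^ 2) *
    Complex.exp (2 * Real.pi * Complex.I * (z + 1 / 2) * ((n : ℂ) + 1 / 2))

/-- The Dedekind eta function η(τ) = q^{1/24} ∏_{n≥1} (1 - qⁿ). -/
noncomputable def dedekindEta (τ : ℂ) : ℂ :=
  Complex.exp (Real.pi * Complex.I * τ / 12) *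
    ∏' n : ℕ, (1 - Complex.exp (2 * Real.pi * Complex.I * τ) ^ (n + 1))

/-- Partial products of the Euler function. -/
noncomputable def eulerQ (q : ℂ) (n : ℕ) : ℂ := ∏ i ∈ Finset.range n, (1 - q ^ (i + 1))

/-- Gaussian binomial coefficients. -/
noncomputable def gaussB (q : ℂ) : ℕ → ℕ → ℂ
  | _, 0 => 1
  | 0, _ + 1 => 0
  | n + 1, j + 1 => gaussB q n j + q ^ (j + 1) * gaussB q n (j + 1)

lemma gaussB_zero_right (q : ℂ) (n : ℕ) : gaussB q n 0 = 1 := by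
  cases n <;> simp [gaussB]

lemma gaussB_of_lt (q : ℂ) (n j : ℕ) (h : n < j) : gaussB q n j = 0 := by
  induction n generalizing j with
  | zero => cases j with
    | zero => omega
    | succ j => simp [gaussB]
  | succ n ih => cases j with
    | zero => omega
    | succ j => rw [gaussB, ih j (by omega), ih (j + 1) (by omega)]; simp

lemma gaussB_mul (q : ℂ) (n j r : ℕ) (h : n = j + r) :
    gaussB q n j * eulerQ q j * eulerQ q r = eulerQ q n := by
  induction n generalizing j r with
  | zero =>
    obtain rfl : j = 0 := by omega
    obtain rfl : r = 0 := by omega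
    simp [gaussB, eulerQ]
  | succ n ih =>
    cases j with
    | zero =>
      obtain rfl : r = n + 1 := by omega
      simp [gaussB, eulerQ]
    | succ j =>
      have h1 := ih j r (by omega)
      have e : eulerQ q (j + 1) = eulerQ q j * (1 - q ^ (j + 1)) := by
        simp [eulerQ, Finset.prod_range_succ]
      have e' : eulerQ q (n + 1) = eulerQ q n * (1 - q ^ (n + 1)) := by
        simp [eulerQ, Finset.prod_range_succ]
      cases r with
      | zero =>
        rw [gaussB, gaussB_of_lt q n (j + 1) (by omega), e, e', ← h1]
        obtain rfl : n = j := by omega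
        ring
      | succ r =>
        have h2 := ih (j + 1) r (by omega)
        have e2 : eulerQ q (r + 1) = eulerQ q r * (1 - q ^ (r + 1)) := by
          simp [eulerQ, Finset.prod_range_succ]
        rw [e] at h2
        rw [e2] at h1
        rw [gaussB, e, e', e2]
        obtain rfl : n = j + r + 1 := by omega
        linear_combination (1 - q ^ (j + 1)) * h1 + q ^ (j + 1) * (1 - q ^ (r + 1)) * h2

lemma gaussB_thm (q : ℂ) (n : ℕ) (X : ℂ) :
    ∏ k ∈ Finset.range n, (1 - X * q ^ k) =
      ∑ j ∈ Finset.range (n + 1), (-1) ^ j * q ^ (j.choose 2) * gaussB q n j * X ^ j := by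
  induction n generalizing X with
  | zero => simp [gaussB]
  | succ n ih =>
    rw [Finset.prod_range_succ']
    have e : ∏ k ∈ Finset.range n, (1 - X * q ^ (k + 1)) =
        ∏ k ∈ Finset.range n, (1 - (X * q) * q ^ k) :=
      Finset.prod_congr rfl fun k _ => by ring
    rw [e, ih (X * q), Finset.sum_range_succ' _ (n + 1)]
    have e3 : ∑ j ∈ Finset.range (n + 1), (-1) ^ j * q ^ (j.choose 2) * gaussB q n j * (X * q) ^ j
        = ∑ j ∈ Finset.range (n + 1), (-1) ^ (j + 1) * q ^ ((j + 1).choose 2) *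
          gaussB q n (j + 1) * (X * q) ^ (j + 1) + 1 := by
      have := Finset.sum_range_succ' (fun j => (-1) ^ j * q ^ (j.choose 2) * gaussB q n j *
        (X * q) ^ j) (n + 1)
      rw [Finset.sum_range_succ] at this
      simpa [gaussB_of_lt q n (n + 1) (by omega), gaussB_zero_right] using this
    have e4 : ∀ S : ℂ, S * (1 - X * q ^ 0) = S - X * S := fun S => by ring
    rw [e4]
    nth_rewrite 1 [e3]
    rw [Finset.mul_sum]
    simp only [gaussB_zero_right, pow_zero, Nat.choose_zero_succ, mul_one]
    rw [add_sub_right_comm, ← Finset.sum_sub_distrib]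
    congr 1
    refine Finset.sum_congr rfl fun j _ => ?_
    have hc : (j + 1).choose 2 = j + j.choose 2 := by
      rw [Nat.choose_succ_succ' j 1]; simp
    rw [gaussB, hc]
    ring

lemma finite_identity (τ : ℂ) (m : ℕ) :
    ∑ j ∈ Finset.range (2 * m + 2), (-1) ^ j *
      Complex.exp (Real.pi * Complex.I * τ * (((m : ℂ) - j) + 1 / 2) ^ 2) *
      (((m : ℂ) - j) + 1 / 2) * gaussB (Complex.exp (2 * Real.pi * Complex.I * τ)) (2 * m + 1) j
    = (-1) ^ m * Complex.exp (Real.pi * Complex.I * τ / 4) *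
      eulerQ (Complex.exp (2 * Real.pi * Complex.I * τ)) m ^ 2 := by
  set q := Complex.exp (2 * Real.pi * Complex.I * τ) with hq
  have hq0 : q ≠ 0 := Complex.exp_ne_zero _
  set t : ℕ → ℂ := fun j => (-1) ^ j * q ^ (j.choose 2) * gaussB q (2 * m + 1) j with ht
  set X : ℂ := (q ^ m)⁻¹ with hX
  have hXq : X * q ^ m = 1 := inv_mul_cancel₀ (pow_ne_zero _ hq0)
  set A : ℂ → ℂ := fun x => ∏ k ∈ Finset.range m, (1 - x * q ^ k) with hA
  set B : ℂ → ℂ := fun x => ∏ k ∈ Finset.range m, (1 - x * q ^ (m + 1 + k)) with hB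
  have hAB : ∀ x, A x * (1 - x * q ^ m) * B x = ∑ j ∈ Finset.range (2 * m + 2), t j * x ^ j := by
    intro x
    rw [← gaussB_thm q (2 * m + 1) x, show 2 * m + 1 = (m + 1) + m by ring, Finset.prod_range_add,
      Finset.prod_range_succ]
  have hs0 : ∑ j ∈ Finset.range (2 * m + 2), t j * X ^ j = 0 := by
    rw [← hAB, hXq]; simp
  have hdA : DifferentiableAt ℂ A X := by
    simp only [hA]; fun_prop
  have hdB : DifferentiableAt ℂ B X := by
    simp only [hB]; fun_prop
  have hd1 : HasDerivAt (fun x => A x * (1 - x * q ^ m) * B x) (-(q ^ m) * A X * B X) X := by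
    have h1 : HasDerivAt (fun x : ℂ => 1 - x * q ^ m) (-(q ^ m)) X := by
      simpa using ((hasDerivAt_id X).mul_const (q ^ m)).const_sub 1
    refine HasDerivAt.congr_deriv ((hdA.hasDerivAt.fun_mul h1).fun_mul hdB.hasDerivAt) ?_
    rw [hXq]
    ring
  have hd2 : HasDerivAt (fun x => ∑ j ∈ Finset.range (2 * m + 2), t j * x ^ j)
      (∑ j ∈ Finset.range (2 * m + 2), t j * (j * X ^ (j - 1))) X :=
    HasDerivAt.fun_sum fun j _ => (hasDerivAt_pow j X).const_mul (t j)
  rw [funext hAB] at hd1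
  have hs1' := hd2.unique hd1
  have hs1 : ∑ j ∈ Finset.range (2 * m + 2), t j * X ^ j * j = - (A X * B X) := by
    have : X * ∑ j ∈ Finset.range (2 * m + 2), t j * (j * X ^ (j - 1)) =
        ∑ j ∈ Finset.range (2 * m + 2), t j * X ^ j * j := by
      rw [Finset.mul_sum]
      refine Finset.sum_congr rfl fun j _ => ?_
      cases j with
      | zero => simp
      | succ j => simp only [Nat.add_sub_cancel]; ring
    rw [← this, hs1']
    linear_combination (-(A X * B X)) * hXq
  have hBX : B X = eulerQ q m := by
    refine Finset.prod_congr rfl fun k _ => ?_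
    rw [show m + 1 + k = m + (k + 1) by ring, pow_add, ← mul_assoc, hXq, one_mul]
  have hE : ∀ m : ℕ, Complex.exp (Real.pi * Complex.I * τ * ((m : ℂ) ^ 2 + m)) =
      ∏ k ∈ Finset.range m, q ^ (k + 1) := by
    intro m
    induction m with
    | zero => simp
    | succ m ih =>
      rw [Finset.prod_range_succ, ← ih, hq, ← Complex.exp_nat_mul, ← Complex.exp_add]
      congr 1
      push_cast
      ring
  have hAX : A X * Complex.exp (Real.pi * Complex.I * τ * ((m : ℂ) ^ 2 + m)) =
      (-1) ^ m * eulerQ q m := by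
    have : A X = ∏ k ∈ Finset.range m, (1 - (q ^ (k + 1))⁻¹) := by
      rw [← Finset.prod_range_reflect]
      refine Finset.prod_congr rfl fun k hk => ?_
      have hk := Finset.mem_range.1 hk
      congr 1
      rw [hX]
      have : q ^ m = q ^ k * q ^ (m - 1 - k + 1) := by
        rw [← pow_add]; congr 1; omega
      have h1 : q ^ k ≠ 0 := pow_ne_zero _ hq0
      rw [this, mul_inv, mul_right_comm, inv_mul_cancel₀ h1, one_mul]
    rw [this, hE, ← Finset.prod_mul_distrib, eulerQ]
    have h3 : (-1 : ℂ) ^ m = ∏ _k ∈ Finset.range m, (-1 : ℂ) := by simp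
    rw [h3, ← Finset.prod_mul_distrib]
    refine Finset.prod_congr rfl fun k _ => ?_
    have h2 : q ^ (k + 1) ≠ 0 := pow_ne_zero _ hq0
    field_simp
    ring
  have hterm : ∀ j : ℕ, Complex.exp (Real.pi * Complex.I * τ * (((m : ℂ) - j) + 1 / 2) ^ 2) =
      Complex.exp (Real.pi * Complex.I * τ / 4) *
      Complex.exp (Real.pi * Complex.I * τ * ((m : ℂ) ^ 2 + m)) * (q ^ (j.choose 2) * X ^ j) := by
    intro j
    have hXe : X = Complex.exp (-(m * (2 * Real.pi * Complex.I * τ))) := by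
      rw [Complex.exp_neg, Complex.exp_nat_mul]
    rw [hXe, hq, ← Complex.exp_nat_mul, ← Complex.exp_nat_mul, ← Complex.exp_add,
      ← Complex.exp_add, ← Complex.exp_add, Nat.cast_choose_two]
    congr 1
    ring
  have hfin : ∑ j ∈ Finset.range (2 * m + 2), (-1) ^ j *
      Complex.exp (Real.pi * Complex.I * τ * (((m : ℂ) - j) + 1 / 2) ^ 2) *
      (((m : ℂ) - j) + 1 / 2) * gaussB q (2 * m + 1) j =
      Complex.exp (Real.pi * Complex.I * τ / 4) *
      Complex.exp (Real.pi * Complex.I * τ * ((m : ℂ) ^ 2 + m)) *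
      ((m + 1 / 2) * ∑ j ∈ Finset.range (2 * m + 2), t j * X ^ j -
        ∑ j ∈ Finset.range (2 * m + 2), t j * X ^ j * j) := by
    rw [Finset.mul_sum, ← Finset.sum_sub_distrib, Finset.mul_sum]
    refine Finset.sum_congr rfl fun j _ => ?_
    rw [hterm, ht]
    ring
  rw [hfin, hs0, hs1, hBX]
  linear_combination Complex.exp (Real.pi * Complex.I * τ / 4) * eulerQ q m * hAX

/-- Terms of the differentiated theta series. -/
noncomputable def wTerm (τ : ℂ) (l : ℤ) : ℂ :=
  (-1) ^ l * Complex.exp (Real.pi * Complex.I * τ * ((l : ℂ) + 1 / 2) ^ 2) * ((l : ℂ) + 1 / 2)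

lemma finite_identity' (τ : ℂ) (m : ℕ) :
    ∑ l ∈ Finset.Icc (-(m : ℤ) - 1) m, wTerm τ l *
      gaussB (Complex.exp (2 * Real.pi * Complex.I * τ)) (2 * m + 1) (m - l).toNat
    = Complex.exp (Real.pi * Complex.I * τ / 4) *
      eulerQ (Complex.exp (2 * Real.pi * Complex.I * τ)) m ^ 2 := by
  have h := finite_identity τ m
  have hm : ((-1 : ℂ) ^ m) * (-1) ^ m = 1 := by
    rw [← mul_pow]; simp
  have h2 : Complex.exp (Real.pi * Complex.I * τ / 4) *
      eulerQ (Complex.exp (2 * Real.pi * Complex.I * τ)) m ^ 2 = (-1) ^ m * ((-1) ^ m *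
      Complex.exp (Real.pi * Complex.I * τ / 4) *
      eulerQ (Complex.exp (2 * Real.pi * Complex.I * τ)) m ^ 2) := by
    linear_combination (-(Complex.exp (Real.pi * Complex.I * τ / 4) *
      eulerQ (Complex.exp (2 * Real.pi * Complex.I * τ)) m ^ 2)) * hm
  rw [h2, ← h, Finset.mul_sum]
  refine Finset.sum_bij' (fun l _ => (m - l).toNat) (fun j _ => (m : ℤ) - j) ?_ ?_ ?_ ?_ ?_
  · intro l hl
    rw [Finset.mem_Icc] at hl
    rw [Finset.mem_range]; omega
  · intro j hj
    rw [Finset.mem_range] at hj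
    rw [Finset.mem_Icc]; omega
  · intro l hl
    rw [Finset.mem_Icc] at hl
    omega
  · intro j hj
    omega
  · intro l hl
    rw [Finset.mem_Icc] at hl
    obtain ⟨j, hj⟩ : ∃ j : ℕ, l = m - j := ⟨(m - l).toNat, by omega⟩
    have hj' : (m - l).toNat = j := by omega
    rw [hj', hj, wTerm, zpow_sub₀ (by norm_num)]
    push_cast
    have : ((-1 : ℂ) ^ j)⁻¹ = (-1) ^ j := by
      rw [← inv_pow]; norm_num
    rw [div_eq_mul_inv, zpow_natCast, zpow_natCast, this]
    ring

lemma norm_q_lt (τ : ℂ) (hτ : 0 < τ.im) : ‖Complex.exp (2 * Real.pi * Complex.I * τ)‖ < 1 :=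
  UpperHalfPlane.norm_exp_two_pi_I_lt_one ⟨τ, hτ⟩

lemma theta_deriv (τ : ℂ) (hτ : 0 < τ.im) :
    Summable (wTerm τ) ∧
    deriv (fun z : ℂ => jTheta z τ) 0 = -2 * Real.pi * ∑' l, wTerm τ l := by
  have hfun : (fun z : ℂ => jTheta z τ) = fun z =>
      Complex.exp (Real.pi * Complex.I * τ / 4 + Real.pi * Complex.I * (z + 1 / 2)) *
        jacobiTheta₂ (z + (1 / 2 + τ / 2)) τ := by
    funext z
    rw [jTheta, jacobiTheta₂, ← tsum_mul_left]
    refine tsum_congr fun n => ?_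
    rw [jacobiTheta₂_term, ← Complex.exp_add, ← Complex.exp_add]
    congr 1
    ring
  have h1 : HasDerivAt (fun z : ℂ => jacobiTheta₂ (z + (1 / 2 + τ / 2)) τ)
      (jacobiTheta₂' (1 / 2 + τ / 2) τ) 0 := by
    have := hasDerivAt_jacobiTheta₂_fst (0 + (1 / 2 + τ / 2)) hτ
    simpa using this.comp_add_const 0 (1 / 2 + τ / 2)
  have h2 : HasDerivAt (fun z : ℂ => Complex.exp (Real.pi * Complex.I * τ / 4 +
      Real.pi * Complex.I * (z + 1 / 2))) (Complex.exp (Real.pi * Complex.I * τ / 4 +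
      Real.pi * Complex.I * (0 + 1 / 2)) * (Real.pi * Complex.I)) 0 := by
    apply HasDerivAt.cexp
    have := (((hasDerivAt_id (0 : ℂ)).add_const (1 / 2)).const_mul
      (Real.pi * Complex.I)).const_add (Real.pi * Complex.I * τ / 4)
    rw [mul_one] at this
    exact this
  have h3 := (h2.mul h1).deriv
  have hs1 := hasSum_jacobiTheta₂_term (1 / 2 + τ / 2) hτ
  have hs2 := hasSum_jacobiTheta₂'_term (1 / 2 + τ / 2) hτ
  have hs := (hs1.mul_left (Complex.exp (Real.pi * Complex.I * τ / 4 +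
      Real.pi * Complex.I * (0 + 1 / 2)) * (Real.pi * Complex.I))).add
      (hs2.mul_left (Complex.exp (Real.pi * Complex.I * τ / 4 +
      Real.pi * Complex.I * (0 + 1 / 2))))
  have hpi : (Real.pi : ℂ) ≠ 0 := by exact_mod_cast Real.pi_ne_zero
  have hs3 : HasSum (fun l => -2 * Real.pi * wTerm τ l) (deriv (fun z : ℂ => jTheta z τ) 0) := by
    rw [hfun]
    have h3' : deriv (fun z => Complex.exp (Real.pi * Complex.I * τ / 4 +
      Real.pi * Complex.I * (z + 1 / 2)) *
        jacobiTheta₂ (z + (1 / 2 + τ / 2)) τ) 0 = _ := h3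
    rw [h3', zero_add (1 / 2 + τ / 2)]
    have hcongr : (fun l => -2 * Real.pi * wTerm τ l) = fun b : ℤ =>
        Complex.exp (Real.pi * Complex.I * τ / 4 + Real.pi * Complex.I * (0 + 1 / 2)) *
          (Real.pi * Complex.I) * jacobiTheta₂_term b (1 / 2 + τ / 2) τ +
        Complex.exp (Real.pi * Complex.I * τ / 4 + Real.pi * Complex.I * (0 + 1 / 2)) *
          jacobiTheta₂'_term b (1 / 2 + τ / 2) τ := by
      funext l
      rw [jacobiTheta₂'_term, jacobiTheta₂_term, wTerm]
      have e1 : ((-1 : ℂ)) ^ l = Complex.exp (l * (Real.pi * Complex.I)) := by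
        rw [Complex.exp_int_mul, Complex.exp_pi_mul_I]
      have e2 : Complex.exp (Real.pi * Complex.I * τ / 4 + Real.pi * Complex.I * (0 + 1 / 2)) *
          Complex.exp (2 * Real.pi * Complex.I * l * (1 / 2 + τ / 2) +
            Real.pi * Complex.I * l ^ 2 * τ) =
          Complex.exp (Real.pi / 2 * Complex.I) * (Complex.exp (l * (Real.pi * Complex.I)) *
          Complex.exp (Real.pi * Complex.I * τ * ((l : ℂ) + 1 / 2) ^ 2)) := by
        rw [← Complex.exp_add, ← Complex.exp_add, ← Complex.exp_add]
        congr 1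
        ring
      rw [Complex.exp_pi_div_two_mul_I] at e2
      rw [e1]
      have hI : Complex.I * Complex.I = -1 := Complex.I_mul_I
      linear_combination (-(2 * Real.pi * Complex.I * (l + 1 / 2))) * e2 -
        (2 * Real.pi * (l + 1 / 2)) * (Complex.exp (l * (Real.pi * Complex.I)) *
          Complex.exp (Real.pi * Complex.I * τ * ((l : ℂ) + 1 / 2) ^ 2)) * hI
    rw [hcongr]
    exact hs
  have hsum : Summable (wTerm τ) :=
    (summable_mul_left_iff (by simp)).1 hs3.summable
  exact ⟨hsum, by rw [← tsum_mul_left]; exact hs3.tsum_eq.symm⟩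

lemma eulerQ_ne_zero (q : ℂ) (hq : ‖q‖ < 1) (n : ℕ) : eulerQ q n ≠ 0 := by
  rw [eulerQ, Finset.prod_ne_zero_iff]
  intro i _ h
  have h1 : q ^ (i + 1) = 1 := (sub_eq_zero.1 h).symm
  have h2 : ‖q‖ ^ (i + 1) < 1 := pow_lt_one₀ (norm_nonneg _) hq (by omega)
  rw [← norm_pow, h1] at h2
  simp at h2

lemma gaussB_eq (q : ℂ) (hq : ‖q‖ < 1) (n j r : ℕ) (h : n = j + r) :
    gaussB q n j = eulerQ q n * (eulerQ q j)⁻¹ * (eulerQ q r)⁻¹ := by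
  have h1 := eulerQ_ne_zero q hq j
  have h2 := eulerQ_ne_zero q hq r
  rw [← gaussB_mul q n j r h]
  field_simp

lemma wTerm_tsum (τ : ℂ) (hτ : 0 < τ.im) (hsum : Summable (wTerm τ)) :
    ∑' l, wTerm τ l = Complex.exp (Real.pi * Complex.I * τ / 4) *
      (∏' n : ℕ, (1 - Complex.exp (2 * Real.pi * Complex.I * τ) ^ (n + 1))) ^ 3 := by
  have hq := norm_q_lt τ hτ
  have hP0 : (∏' n : ℕ, (1 - Complex.exp (2 * Real.pi * Complex.I * τ) ^ (n + 1))) ≠ 0 := by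
    have := ModularForm.eta_tprod_ne_zero (z := τ) hτ
    simpa only [ModularForm.eta_q_eq_pow] using this
  have hfin := finite_identity' τ
  set q := Complex.exp (2 * Real.pi * Complex.I * τ) with hqdef
  set P := ∏' n : ℕ, (1 - q ^ (n + 1)) with hP
  have hlim : Filter.Tendsto (eulerQ q) Filter.atTop (nhds P) :=
    (ModularForm.multipliable_one_sub_pow hq).hasProd.tendsto_prod_nat
  have hinv : Filter.Tendsto (fun n => (eulerQ q n)⁻¹) Filter.atTop (nhds P⁻¹) := hlim.inv₀ hP0
  obtain ⟨C, hC⟩ := (Metric.isBounded_range_of_tendsto _ hlim).exists_norm_le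
  obtain ⟨D, hD⟩ := (Metric.isBounded_range_of_tendsto _ hinv).exists_norm_le
  replace hC : ∀ n, ‖eulerQ q n‖ ≤ C := fun n => hC _ ⟨n, rfl⟩
  replace hD : ∀ n, ‖(eulerQ q n)⁻¹‖ ≤ D := fun n => hD _ ⟨n, rfl⟩
  have hC0 : 0 ≤ C := (norm_nonneg _).trans (hC 0)
  have hD0 : 0 ≤ D := (norm_nonneg _).trans (hD 0)
  let F : ℕ → ℤ → ℂ := fun m l => if l ∈ Finset.Icc (-(m : ℤ) - 1) m then
    wTerm τ l * gaussB q (2 * m + 1) (m - l).toNat else 0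
  have hF : ∀ m : ℕ, ∀ l ∈ Finset.Icc (-(m : ℤ) - 1) m, F m l = wTerm τ l *
      (eulerQ q (2 * m + 1) * (eulerQ q (m - l).toNat)⁻¹ * (eulerQ q (m + 1 + l).toNat)⁻¹) := by
    intro m l hl
    simp only [F, if_pos hl]
    rw [Finset.mem_Icc] at hl
    rw [gaussB_eq q hq (2 * m + 1) (m - l).toNat (m + 1 + l).toNat (by omega)]
  have hFsum : ∀ m, ∑' l, F m l = Complex.exp (Real.pi * Complex.I * τ / 4) * eulerQ q m ^ 2 := by
    intro m
    rw [← hfin m, tsum_eq_sum (s := Finset.Icc (-(m : ℤ) - 1) m)]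
    · exact Finset.sum_congr rfl fun l hl => if_pos hl
    · exact fun l hl => if_neg hl
  have hT : Filter.Tendsto (fun m => ∑' l, F m l) Filter.atTop (nhds (∑' l, wTerm τ l * P⁻¹)) := by
    refine tendsto_tsum_of_dominated_convergence (bound := fun l => ‖wTerm τ l‖ * (C * D * D))
      (hsum.norm.mul_right _) ?_ ?_
    · intro l
      have t1 : Filter.Tendsto (fun m : ℕ => 2 * m + 1) Filter.atTop Filter.atTop :=
        Filter.tendsto_atTop_mono (fun m => by dsimp; omega) Filter.tendsto_id
      have t2 : Filter.Tendsto (fun m : ℕ => ((m : ℤ) - l).toNat) Filter.atTop Filter.atTop :=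
        Filter.tendsto_atTop.2 fun b => by
          filter_upwards [Filter.eventually_ge_atTop (b + l.natAbs)] with m hm
          omega
      have t3 : Filter.Tendsto (fun m : ℕ => ((m : ℤ) + 1 + l).toNat) Filter.atTop Filter.atTop :=
        Filter.tendsto_atTop.2 fun b => by
          filter_upwards [Filter.eventually_ge_atTop (b + l.natAbs)] with m hm
          omega
      have t4 := (((hlim.comp t1).mul (hinv.comp t2)).mul (hinv.comp t3)).const_mul (wTerm τ l)
      rw [mul_inv_cancel₀ hP0, one_mul] at t4
      refine t4.congr' ?_
      filter_upwards [Filter.eventually_ge_atTop l.natAbs] with m hm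
      exact (hF m l (by rw [Finset.mem_Icc]; omega)).symm
    · refine Filter.Eventually.of_forall fun m l => ?_
      by_cases hl : l ∈ Finset.Icc (-(m : ℤ) - 1) m
      · rw [hF m l hl, norm_mul, norm_mul, norm_mul]
        gcongr
        · exact hC _
        · exact hD _
        · exact hD _
      · simp only [F, if_neg hl, norm_zero]
        positivity
  have hT2 : Filter.Tendsto (fun m => ∑' l, F m l) Filter.atTop
      (nhds (Complex.exp (Real.pi * Complex.I * τ / 4) * P ^ 2)) := by
    simp only [hFsum]
    exact (hlim.pow 2).const_mul _
  have := tendsto_nhds_unique hT hT2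
  rw [tsum_mul_right] at this
  field_simp at this
  rw [this, mul_comm]

theorem stmt8 (τ : ℂ) (hτ : 0 < τ.im) :
    deriv (fun z : ℂ => jTheta z τ) 0 = -2 * Real.pi * dedekindEta τ ^ 3 := by
  obtain ⟨hs, hd⟩ := theta_deriv τ hτ
  rw [hd, wTerm_tsum τ hτ hs, dedekindEta, mul_pow, ← Complex.exp_nat_mul]
  congr 3
  push_cast
  ring_nf
end

section
/- For τ ∈ ℍ and z₁, z₂ ∈ ℂ with 0 < Im(z₁) < Im(τ) and 0 < Im(z₂) < Im(τ), the identity ∑_{ℓ∈ℤ} ζ₁^ℓ/(1 - ζ₂ q^ℓ) = -i·η(τ)³·ϑ(z₁+z₂;τ)/(ϑ(z₁;τ)·ϑ(z₂;τ)) holds, where ζⱼ = e^{2πizⱼ} and q = e^{2πiτ}. -/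
open Filter Topology

/-- w n = (-1)^n q^{n(n-1)/2} -/
noncomputable def kw (q : ℂ) (n : ℤ) : ℂ := (-1) ^ n * q ^ (n * (n - 1) / 2)

lemma kw_zero (q : ℂ) : kw q 0 = 1 := by simp [kw]

lemma kw_succ {q : ℂ} (hq : q ≠ 0) (n : ℤ) : kw q (n + 1) = -q ^ n * kw q n := by
  have : (n + 1) * (n + 1 - 1) / 2 = n * (n - 1) / 2 + n := by
    rw [← Int.add_mul_ediv_right _ _ (by norm_num : (2:ℤ) ≠ 0)]
    congr 1; ring
  rw [kw, kw, this, zpow_add₀ hq, zpow_add_one₀ (by norm_num)]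
  ring

lemma kw_refl (q : ℂ) (n : ℤ) : kw q (1 - n) = - kw q n := by
  have : (1 - n) * (1 - n - 1) = n * (n - 1) := by ring
  rw [kw, kw, this, zpow_sub₀ (by norm_num), zpow_one]
  have h : ((-1 : ℂ) ^ n) * ((-1 : ℂ) ^ n) = 1 := by
    rw [← mul_zpow]; norm_num
  have h0 : ((-1 : ℂ) ^ n) ≠ 0 := zpow_ne_zero _ (by norm_num)
  field_simp
  rw [pow_two, h]; ring

lemma kw_ne {q : ℂ} (hq : q ≠ 0) (n : ℤ) : kw q n ≠ 0 :=
  mul_ne_zero (zpow_ne_zero _ (by norm_num)) (zpow_ne_zero _ hq)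

lemma kw_summable_nat {q : ℂ} (hq : q ≠ 0) (hq1 : ‖q‖ < 1) {x : ℂ} (hx : x ≠ 0) :
    Summable (fun n : ℕ => ‖kw q n * x ^ n‖) := by
  refine summable_of_ratio_test_tendsto_lt_one (l := 0) zero_lt_one ?_ ?_
  · exact Eventually.of_forall fun n => by simp [kw_ne hq, hx]
  · have : Tendsto (fun n : ℕ => ‖q‖ ^ n * ‖x‖) atTop (𝓝 (0 * ‖x‖)) :=
      (tendsto_pow_atTop_nhds_zero_of_lt_one (norm_nonneg _) hq1).mul_const _
    rw [zero_mul] at this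
    refine this.congr fun n => ?_
    have h1 : ‖kw q n‖ ≠ 0 := by simp [kw_ne hq]
    have h2 : ‖x‖ ≠ 0 := by simp [hx]
    push_cast
    rw [kw_succ hq]
    simp
    field_simp
    ring

lemma kw_summable {q : ℂ} (hq : q ≠ 0) (hq1 : ‖q‖ < 1) {x : ℂ} (hx : x ≠ 0) :
    Summable (fun n : ℤ => ‖kw q n * x ^ n‖) := by
  refine Summable.of_nat_of_neg ?_ ?_
  · simpa using kw_summable_nat hq hq1 hx
  · have := ((summable_nat_add_iff 1).2 (kw_summable_nat hq hq1 (inv_ne_zero hx))).mul_right ‖x‖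
    refine this.congr fun n => ?_
    have e : (-(n:ℤ)) = 1 - ((n + 1 : ℕ) : ℤ) := by push_cast; ring
    have h2 : ‖x‖ ≠ 0 := by simp [hx]
    conv_rhs => rw [norm_mul, e, kw_refl, norm_neg, ← e]
    simp [pow_succ]
    field_simp

lemma kw_tsum_zero (q : ℂ) (k : ℤ) : ∑' l : ℤ, kw q (k - l) = 0 := by
  have h1 : ∑' l : ℤ, kw q (k - l) = ∑' n, kw q n := (Equiv.subLeft k).tsum_eq (kw q)
  have h2 : ∑' n : ℤ, kw q (1 - n) = ∑' n, kw q n := (Equiv.subLeft 1).tsum_eq (kw q)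
  simp only [kw_refl, tsum_neg] at h2
  rw [h1]
  linear_combination (-1/2) * h2

/-- theta series -/
noncomputable def kth (q x : ℂ) : ℂ := ∑' n : ℤ, kw q n * x ^ n

noncomputable def kE (q a : ℂ) : ℂ := ∏' k : ℕ, (1 + -(a * q ^ k))

lemma kE_summable {q : ℂ} (hq1 : ‖q‖ < 1) (a : ℂ) : Summable (fun k : ℕ => ‖-(a * q ^ k)‖) := by
  simpa using (summable_geometric_of_lt_one (norm_nonneg _) hq1).mul_left ‖a‖

lemma kE_mult {q : ℂ} (hq1 : ‖q‖ < 1) (a : ℂ) : Multipliable (fun k : ℕ => 1 + -(a * q ^ k)) :=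
  multipliable_one_add_of_summable (kE_summable hq1 a)

lemma kE_step {q : ℂ} (hq1 : ‖q‖ < 1) (a : ℂ) : kE q a = (1 - a) * kE q (q * a) := by
  have h := kE_mult hq1 (q * a)
  rw [kE, tprod_eq_zero_mul' (f := fun k : ℕ => 1 + -(a * q ^ k))]
  · simp [kE, pow_succ, sub_eq_add_neg, mul_comm, mul_assoc, mul_left_comm]
  · refine h.congr fun n => ?_
    ring

lemma kE_cont {q : ℂ} (hq1 : ‖q‖ < 1) : Continuous (kE q) := by
  rw [continuous_iff_continuousAt]
  intro a
  refine tendsto_tprod_one_add_of_dominated_convergence (bound := fun k => (‖a‖ + 1) * ‖q‖ ^ k)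
    ((summable_geometric_of_lt_one (norm_nonneg _) hq1).mul_left _) ?_ ?_
  · intro k
    exact Continuous.tendsto (by fun_prop) a
  · have : ∀ᶠ b in 𝓝 a, ‖b‖ < ‖a‖ + 1 :=
      (continuous_norm.tendsto a).eventually (gt_mem_nhds (by linarith))
    filter_upwards [this] with b hb k
    rw [norm_neg, norm_mul, norm_pow]
    gcongr

lemma kE_q_ne {q : ℂ} (hq1 : ‖q‖ < 1) : kE q q ≠ 0 := by
  refine tprod_one_add_ne_zero_of_summable ?_ (kE_summable hq1 q)
  intro k h
  have : q ^ (k+1) = 1 := by linear_combination -h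
  have h2 := congrArg norm this
  rw [norm_pow, norm_one] at h2
  exact absurd h2 (pow_lt_one₀ (norm_nonneg _) hq1 (by omega)).ne

/-- finite product -/
noncomputable def kP (q a : ℂ) (n : ℕ) : ℂ := ∏ k ∈ Finset.range n, (1 + -(a * q ^ k))

lemma kP_tendsto {q : ℂ} (hq1 : ‖q‖ < 1) (a : ℂ) : Tendsto (kP q a) atTop (𝓝 (kE q a)) :=
  (kE_mult hq1 a).tendsto_prod_tprod_nat

lemma kP_succ (q a : ℂ) (n : ℕ) : kP q a (n+1) = kP q a n * (1 - a * q ^ n) := by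
  rw [kP, Finset.prod_range_succ, kP]; ring

lemma kfac_ne {q : ℂ} (hq1 : ‖q‖ < 1) (k : ℕ) : 1 - q ^ (k+1) ≠ 0 := by
  intro h
  have : q ^ (k+1) = 1 := by linear_combination -h
  have h2 := congrArg norm this
  rw [norm_pow, norm_one] at h2
  exact absurd h2 (pow_lt_one₀ (norm_nonneg _) hq1 (by omega)).ne

lemma kP_q_ne {q : ℂ} (hq1 : ‖q‖ < 1) (n : ℕ) : kP q q n ≠ 0 := by
  rw [kP, Finset.prod_ne_zero_iff]
  intro k _
  have := kfac_ne hq1 k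
  convert this using 1
  ring

/-- reciprocal q-factorial extended by zero -/
noncomputable def kr (q : ℂ) (m : ℤ) : ℂ := if 0 ≤ m then (kP q q m.toNat)⁻¹ else 0

lemma kr_step {q : ℂ} (hq1 : ‖q‖ < 1) (m : ℤ) : kr q (m - 1) = (1 - q ^ m) * kr q m := by
  rcases lt_trichotomy m 0 with h | h | h
  · simp [kr, not_le.2 h]
    intro h'; omega
  · subst h; simp [kr]
  · obtain ⟨n, rfl⟩ : ∃ n : ℕ, m = n + 1 := ⟨(m-1).toNat, by omega⟩
    have e : ((n:ℤ) + 1).toNat = n + 1 := by omega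
    have h1 := kP_q_ne hq1 n
    have h2 := kfac_ne hq1 n
    have e2 : q ^ ((n:ℤ) + 1) = q ^ (n+1) := by exact_mod_cast zpow_natCast q (n+1)
    rw [kr, kr, if_pos (by omega), if_pos (by omega), e, kP_succ, e2]
    simp only [add_sub_cancel_right, Int.toNat_natCast]
    rw [mul_inv, ← pow_succ']
    field_simp

lemma kr_tendsto {q : ℂ} (hq1 : ‖q‖ < 1) : Tendsto (kr q) atTop (𝓝 (kE q q)⁻¹) := by
  have h := ((kP_tendsto hq1 q).inv₀ (kE_q_ne hq1)).comp
    (f := Int.toNat) (x := atTop) (by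
      refine tendsto_atTop.2 fun b => ?_
      filter_upwards [eventually_ge_atTop (b:ℤ)] with a ha
      omega)
  refine h.congr' ?_
  filter_upwards [eventually_ge_atTop (0:ℤ)] with a ha
  simp [kr, ha]

lemma kr_bdd {q : ℂ} (hq1 : ‖q‖ < 1) : ∃ M : ℝ, 0 ≤ M ∧ ∀ m, ‖kr q m‖ ≤ M := by
  have h := ((kP_tendsto hq1 q).inv₀ (kE_q_ne hq1)).norm.bddAbove_range
  obtain ⟨M, hM⟩ := h
  have hM' : ∀ n, ‖(kP q q n)⁻¹‖ ≤ M := fun n => hM ⟨n, rfl⟩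
  have h0 : 0 ≤ M := (norm_nonneg _).trans (hM' 0)
  refine ⟨M, h0, fun m => ?_⟩
  unfold kr
  split_ifs
  · exact hM' _
  · simpa using h0

lemma kjtp_fin {q : ℂ} (hq : q ≠ 0) (hq1 : ‖q‖ < 1) {x : ℂ} (hx : x ≠ 0) (n : ℕ) :
    HasSum (fun k : ℤ => kw q k * x ^ k * (kP q q (2*n) * (kr q (n+k) * kr q (n-k))))
      (kP q x n * kP q (q/x) n) := by
  induction n with
  | zero =>
    have := hasSum_single (f := fun k : ℤ => kw q k * x ^ k *
      (kP q q (2*0) * (kr q ((0:ℕ)+k) * kr q ((0:ℕ)-k)))) 0 (by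
        intro k hk
        rcases lt_or_gt_of_ne hk with h | h
        · simp [kr, not_le.2 h]
        · simp [kr, not_le.2 h])
    convert this using 1
    simp [kr, kP, kw_zero]
  | succ n ih =>
    have i1 := ((Equiv.subRight (1:ℤ)).hasSum_iff).2 ih
    have i2 := ((Equiv.addRight (1:ℤ)).hasSum_iff).2 ih
    have := ((ih.mul_left (1 + q ^ (2*n+1))).sub (i1.mul_left (x * q ^ n))).sub
      (i2.mul_left (q ^ (n+1) / x))
    refine (congrArg₂ (fun f a => HasSum f a) ?_ ?_).mpr this
    · funext k
      simp only [Function.comp, Equiv.subRight_apply, Equiv.coe_addRight]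
      have a1 : kr q (n + k) = (1 - q ^ (n + 1 + k : ℤ)) * kr q (n+1+k) := by
        rw [← kr_step hq1]; congr 1; ring
      have a2 : kr q (n - k) = (1 - q ^ (n + 1 - k : ℤ)) * kr q (n+1-k) := by
        rw [← kr_step hq1]; congr 1; ring
      have a3 : kr q (n + (k - 1)) = (1 - q ^ (n + k : ℤ)) * kr q (n+k) := by
        rw [← kr_step hq1]; congr 1; ring
      have a4 : kr q (n - (k + 1)) = (1 - q ^ (n - k : ℤ)) * kr q (n-k) := by
        rw [← kr_step hq1]; congr 1; ring
      have a5 : (n : ℤ) - (k - 1) = n + 1 - k := by ring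
      have a6 : (n : ℤ) + (k + 1) = n + 1 + k := by ring
      have b1 : kw q k = -q ^ (k-1) * kw q (k-1) := by
        rw [← kw_succ hq]; congr 1; ring
      have b2 : kw q (k-1) = - (q * (q ^ k)⁻¹) * kw q k := by
        have : q ^ k ≠ 0 := zpow_ne_zero _ hq
        rw [b1, zpow_sub_one₀ hq]; field_simp
      have c : kP q q (2 * (n+1)) = kP q q (2*n) * (1 - q * q ^ (2*n)) * (1 - q * q ^ (2*n+1)) := by
        rw [show 2 * (n+1) = 2*n+1+1 by ring, kP_succ, kP_succ]
      rw [a3, a4, a5, a6, a1, a2, b2, kw_succ hq, c]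
      push_cast
      generalize kr q (n+1+k) = R
      generalize kr q (n+1-k) = S
      have hk : q ^ k ≠ 0 := zpow_ne_zero _ hq
      simp only [zpow_add₀ hq, zpow_sub₀ hq, zpow_add₀ hx, zpow_sub₀ hx, zpow_one, zpow_natCast]
      field_simp
      ring
    · rw [kP_succ, kP_succ]
      field_simp
      ring

lemma kjtp {q : ℂ} (hq : q ≠ 0) (hq1 : ‖q‖ < 1) {x : ℂ} (hx : x ≠ 0) :
    kth q x = kE q q * kE q x * kE q (q / x) := by
  obtain ⟨M, hM0, hM⟩ := kr_bdd hq1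
  obtain ⟨N, hN⟩ := (kP_tendsto hq1 q).norm.bddAbove_range
  have hN' : ∀ n, ‖kP q q n‖ ≤ N := fun n => hN ⟨n, rfl⟩
  have hN0 : 0 ≤ N := (norm_nonneg _).trans (hN' 0)
  have hE := kE_q_ne hq1
  have key : Tendsto (fun n : ℕ => ∑' k : ℤ, kw q k * x ^ k *
      (kP q q (2*n) * (kr q (n+k) * kr q (n-k)))) atTop
      (𝓝 (∑' k : ℤ, kw q k * x ^ k * (kE q q * ((kE q q)⁻¹ * (kE q q)⁻¹)))) := by
    refine tendsto_tsum_of_dominated_convergence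
      (bound := fun k => ‖kw q k * x ^ k‖ * (N * (M * M)))
      ((kw_summable hq hq1 hx).mul_right _) ?_ ?_
    · intro k
      have hn : Tendsto (fun n : ℕ => (n : ℤ)) atTop atTop := tendsto_natCast_atTop_atTop
      refine Tendsto.const_mul _ (Tendsto.mul ?_ (Tendsto.mul ?_ ?_))
      · exact (kP_tendsto hq1 q).comp (tendsto_id.const_mul_atTop' (by norm_num))
      · exact (kr_tendsto hq1).comp (tendsto_atTop_add_const_right _ _ hn)
      · exact (kr_tendsto hq1).comp (tendsto_atTop_add_const_right _ _ hn)
    · refine Eventually.of_forall fun n k => ?_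
      rw [norm_mul, norm_mul (kP q q (2*n)), norm_mul (kr q _)]
      gcongr
      · exact hN' _
      · exact hM _
      · exact hM _
  have key2 := (kP_tendsto hq1 x).mul (kP_tendsto hq1 (q/x))
  have := tendsto_nhds_unique (key2.congr fun n => ((kjtp_fin hq hq1 hx n).tsum_eq).symm) key
  rw [tsum_mul_right] at this
  rw [mul_assoc, this, kth]
  field_simp

lemma k_geom {ρ : ℝ} (h0 : 0 ≤ ρ) (h1 : ρ < 1) : Summable (fun l : ℤ => ρ ^ l.natAbs) := by
  refine Summable.of_nat_of_neg ?_ ?_ <;>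
  simpa using summable_geometric_of_lt_one h0 h1

/-- the coefficient 1/(1-yq^l) minus indicator of l ≥ 0 -/
noncomputable def kh (q y : ℂ) (l : ℤ) : ℂ := (1 - y * q ^ l)⁻¹ - if 0 ≤ l then 1 else 0

lemma kh_bound {q y : ℂ} (hq : q ≠ 0) (hq1 : ‖q‖ < 1) (hy : ‖q‖ < ‖y‖) (hy1 : ‖y‖ < 1) :
    ∃ B : ℝ, 0 ≤ B ∧ ∀ l : ℤ, 1 - y * q ^ l ≠ 0 ∧ ‖kh q y l‖ ≤ B * ‖q‖ ^ l.natAbs := by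
  have hy' : 0 < 1 - ‖y‖ := by linarith
  have hy'' : 0 < ‖y‖ - ‖q‖ := by linarith
  have hq0 : 0 < ‖q‖ := norm_pos_iff.2 hq
  refine ⟨(1 - ‖y‖)⁻¹ + (‖y‖ - ‖q‖)⁻¹, by positivity, fun l => ?_⟩
  rcases le_or_gt 0 l with hl | hl
  · obtain ⟨n, rfl⟩ := Int.eq_ofNat_of_zero_le hl
    have h1 : ‖y * q ^ n‖ ≤ ‖y‖ := by
      rw [norm_mul, norm_pow]
      exact mul_le_of_le_one_right (norm_nonneg _) (pow_le_one₀ (norm_nonneg _) hq1.le)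
    have h2 : 1 - ‖y‖ ≤ ‖1 - y * q ^ n‖ := by
      have := norm_sub_norm_le (1:ℂ) (y * q ^ n)
      rw [norm_one] at this
      linarith
    have h3 : 1 - y * q ^ n ≠ 0 := norm_pos_iff.1 (by linarith)
    refine ⟨by simpa using h3, ?_⟩
    have e : kh q y n = y * q ^ n * (1 - y * q ^ n)⁻¹ := by
      rw [kh, if_pos (by omega), zpow_natCast]
      field_simp
      ring
    rw [e, norm_mul, norm_inv, norm_mul, norm_pow, Int.natAbs_natCast]
    calc ‖y‖ * ‖q‖ ^ n * ‖1 - y * q ^ n‖⁻¹ ≤ 1 * ‖q‖ ^ n * (1 - ‖y‖)⁻¹ := by gcongr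
      _ = (1 - ‖y‖)⁻¹ * ‖q‖ ^ n := by ring
      _ ≤ _ := by
        gcongr
        have := inv_pos.2 hy''
        linarith
  · obtain ⟨n, rfl⟩ : ∃ n : ℕ, l = -((n + 1 : ℕ) : ℤ) := ⟨(-l-1).toNat, by omega⟩
    have hp : 0 < ‖q‖ ^ (n+1) := by positivity
    have e0 : 1 - y * q ^ (-((n + 1 : ℕ) : ℤ)) = (q ^ (n+1) - y) / q ^ (n+1) := by
      rw [zpow_neg, zpow_natCast]
      field_simp
    have h2 : ‖y‖ - ‖q‖ ≤ ‖q ^ (n+1) - y‖ := by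
      have := norm_sub_norm_le y (q ^ (n+1))
      rw [norm_sub_rev, norm_pow] at this
      have h4 : ‖q‖ ^ (n+1) ≤ ‖q‖ := pow_le_of_le_one (norm_nonneg _) hq1.le (by omega)
      linarith
    have h3 : q ^ (n+1) - y ≠ 0 := norm_pos_iff.1 (by linarith)
    refine ⟨by rw [e0]; exact div_ne_zero h3 (pow_ne_zero _ hq), ?_⟩
    rw [kh, if_neg (by omega), e0, sub_zero, inv_div, norm_div, norm_pow, Int.natAbs_neg,
      Int.natAbs_natCast, div_eq_inv_mul]
    gcongr
    calc ‖q ^ (n+1) - y‖⁻¹ ≤ (‖y‖ - ‖q‖)⁻¹ := by gcongr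
      _ ≤ _ := by
        have := inv_pos.2 hy'
        linarith

lemma k_zpow_le {x : ℂ} {r : ℝ} (hr : 0 < r) (hx : r ≤ ‖x‖) (hx1 : ‖x‖ ≤ 1) (l : ℤ) :
    ‖x ^ l‖ ≤ (r⁻¹) ^ l.natAbs := by
  have hr1 : 1 ≤ r⁻¹ := (one_le_inv₀ hr).2 (hx.trans hx1)
  rcases le_or_gt 0 l with hl | hl
  · obtain ⟨n, rfl⟩ := Int.eq_ofNat_of_zero_le hl
    rw [zpow_natCast, norm_pow, Int.natAbs_natCast]
    exact (pow_le_one₀ (norm_nonneg _) hx1).trans (one_le_pow₀ hr1)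
  · obtain ⟨n, rfl⟩ : ∃ n : ℕ, l = -((n : ℕ) : ℤ) := ⟨(-l).toNat, by omega⟩
    rw [zpow_neg, zpow_natCast, norm_inv, norm_pow, Int.natAbs_neg, Int.natAbs_natCast, ← inv_pow]
    gcongr

lemma k_term_bound {q y : ℂ} {B : ℝ} (hB : 0 ≤ B)
    (hb : ∀ l : ℤ, ‖kh q y l‖ ≤ B * ‖q‖ ^ l.natAbs) {x : ℂ} {r : ℝ} (hr : 0 < r)
    (hx : r ≤ ‖x‖) (hx1 : ‖x‖ ≤ 1) (l : ℤ) :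
    ‖x ^ l * kh q y l‖ ≤ B * (‖q‖ / r) ^ l.natAbs := by
  rw [norm_mul]
  calc _ ≤ (r⁻¹) ^ l.natAbs * (B * ‖q‖ ^ l.natAbs) := by
        gcongr
        · exact k_zpow_le hr hx hx1 l
        · exact hb l
    _ = _ := by rw [div_eq_mul_inv, mul_pow]; ring

lemma k_geom_ind {x : ℂ} (hx1 : ‖x‖ < 1) :
    HasSum (fun l : ℤ => x ^ l * if 0 ≤ l then (1:ℂ) else 0) (1 - x)⁻¹ := by
  have := HasSum.of_nat_of_neg_add_one (f := fun l : ℤ => x ^ l * if 0 ≤ l then (1:ℂ) else 0)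
    (m := (1 - x)⁻¹) (m' := 0) (by simpa using hasSum_geometric_of_norm_lt_one hx1) (by
      convert hasSum_zero using 2 with n
      rw [if_neg (by omega), mul_zero])
  simpa using this

lemma k_geom_ind_norm {x : ℂ} (hx1 : ‖x‖ < 1) :
    Summable (fun l : ℤ => ‖x ^ l * if 0 ≤ l then (1:ℂ) else 0‖) :=
  (k_geom_ind hx1).summable.norm

/-- Appell-Lerch sum -/
noncomputable def kF (q x y : ℂ) : ℂ := ∑' l : ℤ, x ^ l / (1 - y * q ^ l)

lemma k_split (q x y : ℂ) (l : ℤ) : x ^ l / (1 - y * q ^ l) =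
    x ^ l * kh q y l + x ^ l * if 0 ≤ l then (1:ℂ) else 0 := by
  rw [kh]; ring

lemma k_summ {q y : ℂ} {B : ℝ} (hB : 0 ≤ B)
    (hb : ∀ l : ℤ, ‖kh q y l‖ ≤ B * ‖q‖ ^ l.natAbs) {x : ℂ} {r : ℝ} (hr : 0 < r) (hqr : ‖q‖ < r)
    (hx : r ≤ ‖x‖) (hx1 : ‖x‖ ≤ 1) : Summable (fun l : ℤ => x ^ l * kh q y l) :=
  Summable.of_norm_bounded
    ((k_geom (div_nonneg (norm_nonneg q) hr.le) ((div_lt_one hr).2 hqr)).mul_left B)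
    (k_term_bound hB hb hr hx hx1)

lemma kF_bound {q y : ℂ} (hq : q ≠ 0) (hq1 : ‖q‖ < 1) (hy : ‖q‖ < ‖y‖) (hy1 : ‖y‖ < 1)
    {r : ℝ} (hqr : ‖q‖ < r) : ∃ A : ℝ, ∀ x : ℂ, r ≤ ‖x‖ → ‖x‖ < 1 →
      ‖kF q x y - (1 - x)⁻¹‖ ≤ A := by
  obtain ⟨B, hB, hb⟩ := kh_bound hq hq1 hy hy1
  have hr : 0 < r := (norm_nonneg _).trans_lt hqr
  refine ⟨∑' l : ℤ, B * (‖q‖ / r) ^ l.natAbs, fun x hx hx1 => ?_⟩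
  have h1 := k_summ hB (fun l => (hb l).2) hr hqr hx hx1.le
  have h2 := k_geom_ind hx1
  have e : kF q x y = ∑' l : ℤ, x ^ l * kh q y l + (1 - x)⁻¹ := by
    rw [kF]
    simp_rw [k_split]
    rw [h1.tsum_add h2.summable, h2.tsum_eq]
  rw [e, add_sub_cancel_right]
  exact tsum_of_norm_bounded
    ((k_geom (div_nonneg (norm_nonneg q) hr.le) ((div_lt_one hr).2 hqr)).mul_left B).hasSum
    (k_term_bound hB (fun l => (hb l).2) hr hx hx1.le)

noncomputable def kc (q y : ℂ) (k : ℤ) : ℂ := ∑' l : ℤ, kw q (k - l) / (1 - y * q ^ l)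

lemma kw_summable_shift {q : ℂ} (hq : q ≠ 0) (hq1 : ‖q‖ < 1) (k : ℤ) :
    Summable (fun l : ℤ => kw q (k - l)) := by
  have := (kw_summable hq hq1 one_ne_zero).of_norm
  simp only [one_zpow, mul_one] at this
  have h := this.comp_injective (Equiv.subLeft k).injective
  refine h.congr fun l => ?_
  simp only [Function.comp_apply, Equiv.subLeft_apply]

lemma kc_summable {q y : ℂ} (hq : q ≠ 0) (hq1 : ‖q‖ < 1) (hy : ‖q‖ < ‖y‖) (hy1 : ‖y‖ < 1)
    (k : ℤ) : Summable (fun l : ℤ => kw q (k - l) / (1 - y * q ^ l)) := by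
  obtain ⟨B, hB, hb⟩ := kh_bound hq hq1 hy hy1
  refine Summable.of_norm_bounded ((kw_summable_shift hq hq1 k).norm.mul_right (B + 1)) fun l => ?_
  rw [div_eq_mul_inv, norm_mul]
  gcongr
  have e : (1 - y * q ^ l)⁻¹ = kh q y l + if 0 ≤ l then 1 else 0 := by rw [kh]; ring
  rw [e]
  refine (norm_add_le _ _).trans (add_le_add ((hb l).2.trans ?_) (by split_ifs <;> simp))
  exact mul_le_of_le_one_right hB (pow_le_one₀ (norm_nonneg _) hq1.le)

lemma kc_succ {q y : ℂ} (hq : q ≠ 0) (hq1 : ‖q‖ < 1) (hy : ‖q‖ < ‖y‖) (hy1 : ‖y‖ < 1)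
    (k : ℤ) : kc q y (k + 1) = - y * q ^ k * kc q y k := by
  obtain ⟨B, hB, hb⟩ := kh_bound hq hq1 hy hy1
  have h1 : ∀ l : ℤ, kw q (k + 1 - l) / (1 - y * q ^ l) =
      kw q (k + 1 - l) + - y * q ^ k * (kw q (k - l) / (1 - y * q ^ l)) := by
    intro l
    have hD := (hb l).1
    have hql : q ^ l ≠ 0 := zpow_ne_zero _ hq
    rw [show k + 1 - l = k - l + 1 by ring, kw_succ hq, zpow_sub₀ hq]
    generalize q ^ l = Q at *
    rw [← mul_div_assoc, ← sub_eq_iff_eq_add', div_sub' hD, div_eq_div_iff hD hD]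
    field_simp
    ring
  rw [kc]
  simp_rw [h1]
  rw [(kw_summable_shift hq hq1 (k+1)).tsum_add ((kc_summable hq hq1 hy hy1 k).mul_left _),
    kw_tsum_zero, zero_add, tsum_mul_left, kc]

lemma kc_eq {q y : ℂ} (hq : q ≠ 0) (hq1 : ‖q‖ < 1) (hy : ‖q‖ < ‖y‖) (hy1 : ‖y‖ < 1)
    (k : ℤ) : kc q y k = kc q y 0 * (kw q k * y ^ k) := by
  have hy0 : y ≠ 0 := norm_pos_iff.1 ((norm_nonneg _).trans_lt hy)
  induction k using Int.induction_on with
  | zero => simp [kw_zero]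
  | succ i ih =>
    rw [kc_succ hq hq1 hy hy1, ih, kw_succ hq, zpow_add_one₀ hy0]; ring
  | pred i ih =>
    have h1 := kc_succ hq hq1 hy hy1 (-(i:ℤ) - 1)
    have h2 := kw_succ hq (-(i:ℤ) - 1)
    have h3 := zpow_add_one₀ hy0 (-(i:ℤ) - 1)
    rw [sub_add_cancel] at h1 h2 h3
    rw [h1, h2, h3] at ih
    have hq' : q ^ (-(i:ℤ) - 1) ≠ 0 := zpow_ne_zero _ hq
    refine mul_left_cancel₀ (mul_ne_zero (neg_ne_zero.2 hy0) hq') ?_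
    rw [ih]; ring

lemma kF_theta {q x y : ℂ} (hq : q ≠ 0) (hq1 : ‖q‖ < 1) (hy : ‖q‖ < ‖y‖) (hy1 : ‖y‖ < 1)
    (hx : ‖q‖ < ‖x‖) (hx1 : ‖x‖ < 1) :
    kF q x y * kth q x = kc q y 0 * kth q (x * y) := by
  have hx0 : x ≠ 0 := norm_pos_iff.1 ((norm_nonneg _).trans_lt hx)
  obtain ⟨B, hB, hb⟩ := kh_bound hq hq1 hy hy1
  have s1 : Summable (fun l : ℤ => ‖x ^ l / (1 - y * q ^ l)‖) := by
    simp_rw [k_split]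
    exact ((k_summ hB (fun l => (hb l).2) (norm_pos_iff.2 hx0) hx le_rfl hx1.le).add
      (k_geom_ind hx1).summable).norm
  have s2 := kw_summable hq hq1 hx0
  let e : ℤ × ℤ ≃ ℤ × ℤ :=
    { toFun := fun p => (p.2, p.1 - p.2)
      invFun := fun p => (p.1 + p.2, p.1)
      left_inv := fun p => by simp
      right_inv := fun p => by simp }
  have s3 := summable_mul_of_summable_norm s1 s2
  rw [kF, kth, tsum_mul_tsum_of_summable_norm s1 s2, ← e.tsum_eq]
  have s4 := e.summable_iff.2 s3
  have := s4.tsum_prod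
  simp only [Function.comp_def] at this
  rw [this, kth, ← tsum_mul_left]
  refine tsum_congr fun k => ?_
  have : ∀ l : ℤ, x ^ (e (k, l)).1 / (1 - y * q ^ (e (k, l)).1) *
      (kw q (e (k, l)).2 * x ^ (e (k, l)).2) = x ^ k * (kw q (k - l) / (1 - y * q ^ l)) := by
    intro l
    have hxl : x ^ l ≠ 0 := zpow_ne_zero _ hx0
    simp only [e, Equiv.coe_fn_mk]
    rw [zpow_sub₀ hx0]
    field_simp
  simp_rw [this]
  rw [tsum_mul_left, ← kc, kc_eq hq hq1 hy hy1, mul_zpow]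
  ring

lemma kc_theta {q y : ℂ} (hq : q ≠ 0) (hq1 : ‖q‖ < 1) (hy : ‖q‖ < ‖y‖) (hy1 : ‖y‖ < 1) :
    kc q y 0 * kth q y = kE q q ^ 3 := by
  have hy0 : y ≠ 0 := norm_pos_iff.1 ((norm_nonneg _).trans_lt hy)
  obtain ⟨r, hqr, hr1⟩ := exists_between hq1
  have hr : 0 < r := (norm_nonneg _).trans_lt hqr
  obtain ⟨A, hA⟩ := kF_bound hq hq1 hy hy1 hqr
  have hc := kE_cont hq1
  have hev : ∀ᶠ t : ℝ in 𝓝[<] 1, r < t ∧ t < 1 := by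
    filter_upwards [Ioo_mem_nhdsLT hr1] with t ht using ht
  have ht1 : Tendsto (fun t : ℝ => (t : ℂ)) (𝓝[<] 1) (𝓝 1) := by
    have : Tendsto (fun t : ℝ => (t : ℂ)) (𝓝 1) (𝓝 ((1 : ℝ) : ℂ)) :=
      Complex.continuous_ofReal.tendsto 1
    rw [Complex.ofReal_one] at this
    exact this.mono_left nhdsWithin_le_nhds
  have hn : ∀ t : ℝ, r < t ∧ t < 1 → ‖(t:ℂ)‖ = t := fun t ht => by
    rw [Complex.norm_real, Real.norm_of_nonneg (hr.trans ht.1).le]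
  -- (1-t) F → 1
  have l1 : Tendsto (fun t : ℝ => (1 - (t:ℂ)) * kF q t y) (𝓝[<] 1) (𝓝 1) := by
    have z : Tendsto (fun t : ℝ => (1 - (t:ℂ)) * (kF q t y - (1 - (t:ℂ))⁻¹)) (𝓝[<] 1) (𝓝 0) := by
      have h0 : Tendsto (fun t : ℝ => ‖1 - (t:ℂ)‖ * A) (𝓝[<] 1) (𝓝 0) := by
        have := ((tendsto_const_nhds (x := (1:ℂ))).sub ht1).norm.mul_const A
        simpa using this
      refine squeeze_zero_norm' ?_ h0
      filter_upwards [hev] with t ht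
      rw [norm_mul]
      gcongr
      exact hA _ (by rw [hn t ht]; exact ht.1.le) (by rw [hn t ht]; exact ht.2)
    have z' := z.add_const 1
    rw [zero_add] at z'
    refine z'.congr' ?_
    filter_upwards [hev] with t ht
    have : (1 - (t:ℂ)) ≠ 0 := by
      rw [sub_ne_zero]; exact_mod_cast ht.2.ne'
    field_simp
    ring
  have l2 : Tendsto (fun t : ℝ => kE q q * kE q (q * t) * kE q (q / t)) (𝓝[<] 1)
      (𝓝 (kE q q * kE q q * kE q q)) := by
    refine (Tendsto.mul tendsto_const_nhds ?_).mul ?_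
    · have := (hc.tendsto _).comp (ht1.const_mul q)
      rwa [mul_one] at this
    · have := (hc.tendsto _).comp ((tendsto_const_nhds (x := q)).div ht1 one_ne_zero)
      rwa [div_one] at this
  have l3 : Tendsto (fun t : ℝ => kc q y 0 * (kE q q * kE q (t * y) * kE q (q / (t * y)))) (𝓝[<] 1)
      (𝓝 (kc q y 0 * (kE q q * kE q y * kE q (q / y)))) := by
    have hty : Tendsto (fun t : ℝ => (t:ℂ) * y) (𝓝[<] 1) (𝓝 y) := by
      simpa using ht1.mul_const y
    refine Tendsto.const_mul _ ((Tendsto.mul tendsto_const_nhds ?_).mul ?_)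
    · exact (hc.tendsto _).comp hty
    · exact (hc.tendsto _).comp ((tendsto_const_nhds (x := q)).div hty hy0)
  have := tendsto_nhds_unique ((l1.mul l2).congr' ?_) l3
  · rw [kjtp hq hq1 hy0, ← this]; ring
  · filter_upwards [hev] with t ht
    have ht0 : (t:ℂ) ≠ 0 := by exact_mod_cast (hr.trans ht.1).ne'
    rw [← kjtp hq hq1 (mul_ne_zero ht0 hy0), ← kF_theta hq hq1 hy hy1
      (by rw [hn t ht]; linarith [ht.1]) (by rw [hn t ht]; exact ht.2), kjtp hq hq1 ht0,
      kE_step hq1 (t:ℂ)]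
    ring

lemma k_main {q x y : ℂ} (hq : q ≠ 0) (hq1 : ‖q‖ < 1) (hx : ‖q‖ < ‖x‖) (hx1 : ‖x‖ < 1)
    (hy : ‖q‖ < ‖y‖) (hy1 : ‖y‖ < 1) :
    kth q x ≠ 0 ∧ kth q y ≠ 0 ∧
      kF q x y = kE q q ^ 3 * kth q (x * y) / (kth q x * kth q y) := by
  have hK : kE q q ^ 3 ≠ 0 := pow_ne_zero _ (kE_q_ne hq1)
  have h1 := kc_theta hq hq1 hx hx1
  have h2 := kc_theta hq hq1 hy hy1
  have n1 : kth q x ≠ 0 := fun h => hK (by rw [← h1, h, mul_zero])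
  have n2 : kth q y ≠ 0 := fun h => hK (by rw [← h2, h, mul_zero])
  refine ⟨n1, n2, ?_⟩
  rw [eq_div_iff (mul_ne_zero n1 n2), ← h2]
  linear_combination kth q y * kF_theta hq hq1 hy hy1 hx hx1

lemma jTheta_eq (z τ : ℂ) : jTheta z τ =
    -Complex.I * Complex.exp (Real.pi * Complex.I * τ / 4) *
      Complex.exp (-(Real.pi * Complex.I * z)) *
      kth (Complex.exp (2 * Real.pi * Complex.I * τ)) (Complex.exp (2 * Real.pi * Complex.I * z)) := by
  rw [kth, ← (Equiv.addRight (1:ℤ)).tsum_eq, ← tsum_mul_left, jTheta]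
  refine tsum_congr fun n => ?_
  rw [Equiv.coe_addRight, kw]
  obtain ⟨m, hm⟩ : ∃ m : ℤ, (n + 1) * (n + 1 - 1) = 2 * m := by
    have := Int.even_mul_succ_self n
    obtain ⟨m, hm⟩ := this
    exact ⟨m, by linarith⟩
  have hm' : ((n:ℂ) + 1) * n = 2 * m := by
    have : (n + 1) * n = 2 * m := by rw [← hm]; ring
    exact_mod_cast this
  rw [hm, Int.mul_ediv_cancel_left _ (by norm_num)]
  have e1 : (-1 : ℂ) ^ (n+1) = Complex.exp ((n + 1) * (Real.pi * Complex.I)) := by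
    rw [← Complex.exp_pi_mul_I, ← Complex.exp_int_mul]; push_cast; rfl
  have e2 : -Complex.I = Complex.exp (-(Real.pi / 2 * Complex.I)) := by
    rw [Complex.exp_neg, Complex.exp_pi_div_two_mul_I, Complex.inv_I]
  rw [e1, e2, ← Complex.exp_int_mul, ← Complex.exp_int_mul]
  simp only [← Complex.exp_add]
  congr 1
  push_cast
  linear_combination (Real.pi * Complex.I * τ) * hm'

theorem stmt10 (τ z₁ z₂ : ℂ) (hτ : 0 < τ.im)
    (h₁ : 0 < z₁.im) (h₁' : z₁.im < τ.im) (h₂ : 0 < z₂.im) (h₂' : z₂.im < τ.im) :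
    ∑' l : ℤ, Complex.exp (2 * Real.pi * Complex.I * z₁) ^ l /
        (1 - Complex.exp (2 * Real.pi * Complex.I * z₂) *
          Complex.exp (2 * Real.pi * Complex.I * τ) ^ l)
      = -Complex.I * dedekindEta τ ^ 3 * jTheta (z₁ + z₂) τ / (jTheta z₁ τ * jTheta z₂ τ) := by
  have hn : ∀ z : ℂ, ‖Complex.exp (2 * Real.pi * Complex.I * z)‖ = Real.exp (-(2 * Real.pi * z.im)) := by
    intro z
    rw [Complex.norm_exp]
    congr 1
    simp
  have hlt : ∀ z w : ℂ, z.im < w.im → ‖Complex.exp (2 * Real.pi * Complex.I * w)‖ <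
      ‖Complex.exp (2 * Real.pi * Complex.I * z)‖ := by
    intro z w h
    rw [hn, hn, Real.exp_lt_exp]
    have := Real.pi_pos
    nlinarith
  have hlt1 : ∀ z : ℂ, 0 < z.im → ‖Complex.exp (2 * Real.pi * Complex.I * z)‖ < 1 := by
    intro z h
    simpa using hlt 0 z (by simpa using h)
  obtain ⟨n1, n2, hm⟩ := k_main (Complex.exp_ne_zero _) (hlt1 τ hτ) (hlt z₁ τ h₁') (hlt1 z₁ h₁)
    (hlt z₂ τ h₂') (hlt1 z₂ h₂)
  rw [kF] at hm
  rw [hm, jTheta_eq, jTheta_eq, jTheta_eq, ← Complex.exp_add]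
  have ed : dedekindEta τ = Complex.exp (Real.pi * Complex.I * τ / 12) *
      kE (Complex.exp (2 * Real.pi * Complex.I * τ)) (Complex.exp (2 * Real.pi * Complex.I * τ)) := by
    rw [dedekindEta, kE]
    congr 1
    refine tprod_congr fun n => ?_
    rw [pow_succ']; ring
  have e3 : Complex.exp (Real.pi * Complex.I * τ / 12) ^ 3 = Complex.exp (Real.pi * Complex.I * τ / 4) := by
    rw [← Complex.exp_nat_mul]; congr 1; push_cast; ring
  have e4 : Complex.exp (-(Real.pi * Complex.I * (z₁ + z₂))) =
      Complex.exp (-(Real.pi * Complex.I * z₁)) * Complex.exp (-(Real.pi * Complex.I * z₂)) := by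
    rw [← Complex.exp_add]; congr 1; ring
  have e5 : 2 * Real.pi * Complex.I * (z₁ + z₂) =
      2 * Real.pi * Complex.I * z₁ + 2 * Real.pi * Complex.I * z₂ := by ring
  rw [ed, mul_pow, e3, e4, e5]
  have a1 := Complex.exp_ne_zero (Real.pi * Complex.I * τ / 4)
  have a2 := Complex.exp_ne_zero (-(Real.pi * Complex.I * z₁))
  have a3 := Complex.exp_ne_zero (-(Real.pi * Complex.I * z₂))
  have a4 := Complex.I_ne_zero
  field_simp
end
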